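/- arXiv:2107.03533 — 3 statements merged into one kernel-verified Lean document; each statement's English description precedes it below -/
import Mathlib

section
/- The matrix J₀ = [[0.995, −1.2, 0], [2, 0.71, 1.15], [−4.75, 0, 0.1]] has a real eigenvalue λ₁ with 1.9 < λ₁ < 2; consequently |arg(λ₁)| = 0 and for every q ∈ (0,1) the quantity ι = q − 2|arg(λ₁)|/π = q is positive, i.e., Matignon's instability condition |arg(λ)| < qπ/2 is satisfied at the equilibrium X₀* = (0,0,0) for every fractional order q ∈ (0,1). -/
/-- The Jacobian matrix of the HNN vector field at the equilibrium `X₀* = (0,0,0)`. -/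
noncomputable def J0 : Matrix (Fin 3) (Fin 3) ℝ :=
  !![0.995, -1.2, 0;
     2, 0.71, 1.15;
     -4.75, 0, 0.1]

/-- `J₀` has a real eigenvalue `λ₁` with `1.9 < λ₁ < 2`; consequently `|arg λ₁| = 0` and for
every `q ∈ (0,1)` the quantity `ι = q − 2|arg λ₁|/π = q` is positive, i.e. Matignon's
instability condition `|arg λ| < qπ/2` is satisfied at `X₀*` for every order `q ∈ (0,1)`. -/
theorem J0_real_eigenvalue_matignon_unstable :
    ∃ lam : ℝ, 1.9 < lam ∧ lam < 2 ∧
      Module.End.HasEigenvalue (Matrix.toLin' J0) lam ∧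
      |Complex.arg (lam : ℂ)| = 0 ∧
      ∀ q : ℝ, 0 < q → q < 1 →
        (q - 2 * |Complex.arg (lam : ℂ)| / Real.pi = q ∧
         0 < q - 2 * |Complex.arg (lam : ℂ)| / Real.pi ∧
         |Complex.arg (lam : ℂ)| < q * Real.pi / 2) := by
  have hc : ContinuousOn (fun x : ℝ => (x - 0.995) * (x - 0.71) * (x - 0.1)
      + 2.4 * (x - 0.1) - 6.555) (Set.Icc 1.9 2) := by fun_prop
  have h0 : (0 : ℝ) ∈ Set.Ioo ((fun x : ℝ => (x - 0.995) * (x - 0.71) * (x - 0.1)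
      + 2.4 * (x - 0.1) - 6.555) 1.9) ((fun x : ℝ => (x - 0.995) * (x - 0.71) * (x - 0.1)
      + 2.4 * (x - 0.1) - 6.555) 2) := by
    constructor <;> norm_num
  obtain ⟨lam, ⟨h1, h2⟩, h3⟩ := intermediate_value_Ioo (by norm_num) hc h0
  have h3 : (lam - 0.995) * (lam - 0.71) * (lam - 0.1) + 2.4 * (lam - 0.1) - 6.555 = 0 := h3
  have hpos : 0 ≤ lam := by norm_num at h1; linarith
  have harg : |Complex.arg (lam : ℂ)| = 0 := by
    rw [Complex.arg_ofReal_of_nonneg hpos, abs_zero]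
  refine ⟨lam, h1, h2, ?_, harg, ?_⟩
  · apply Module.End.hasEigenvalue_of_hasEigenvector
      (x := ![1.2 * (lam - 0.1), -((lam - 0.995) * (lam - 0.1)), -5.7])
    rw [Module.End.hasEigenvector_iff, Module.End.mem_eigenspace_iff]
    constructor
    · rw [Matrix.toLin'_apply]
      ext i
      fin_cases i
      · simp [J0, Matrix.mulVec, dotProduct, Fin.sum_univ_three]
        ring
      · simp [J0, Matrix.mulVec, dotProduct, Fin.sum_univ_three]
        linarith
      · simp [J0, Matrix.mulVec, dotProduct, Fin.sum_univ_three]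
        ring
    · intro h
      have h5 : (-5.7 : ℝ) = 0 := congrFun h 2
      norm_num at h5
  · intro q hq _
    rw [harg]
    have := Real.pi_pos
    refine ⟨by simp, by simpa using hq, by positivity⟩
end

section
/- Let q ∈ (0,1), n ≥ 1, f : ℝⁿ → ℝⁿ, and let x : [0,∞) → ℝⁿ be continuously differentiable and satisfy, componentwise for all t > 0, the fractional-order system (1/Γ(1−q)) ∫₀ᵗ (t−s)^{−q} xᵢ′(s) ds = fᵢ(x(t)). If there exists T > 0 such that x(t+T) = x(t) for all t ≥ 0, then x is constant. In other words, fractional-order autonomous systems D*^q x = f(x) with Caputo derivative of order q ∈ (0,1) cannot have any nonconstant periodic solution. -/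
/-- Caputo fractional derivative of order `q` with starting point `0`. -/
noncomputable def caputo (q : ℝ) (g : ℝ → ℝ) (t : ℝ) : ℝ :=
  (1 / Real.Gamma (1 - q)) * ∫ s in (0:ℝ)..t, (t - s) ^ (-q) * deriv g s

open MeasureTheory Set in
lemma frac_deriv_step (h : ℝ → ℝ) (hc : Continuous h) (T : ℝ) (hT : 0 < T) (p : ℝ) (hp : 0 < p)
    (H : ∀ u > T, ∫ s in (0:ℝ)..T, (u - s) ^ (-p) * h s = 0) :
    ∀ u > T, ∫ s in (0:ℝ)..T, (u - s) ^ (-(p+1)) * h s = 0 := by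
  intro u hu
  obtain ⟨v, hv1, hv2⟩ := exists_between hu
  have hcont : ∀ r : ℝ, ∀ w > T, ContinuousOn (fun s => (w - s) ^ r * h s) (uIcc 0 T) := by
    intro r w hw
    refine ContinuousOn.mul (ContinuousOn.rpow_const (by fun_prop) ?_) hc.continuousOn
    intro s hs
    rw [uIcc_of_le hT.le] at hs
    left
    linarith [hs.2]
  have hnb : Ioi v ∈ nhds u := Ioi_mem_nhds hv2
  have key := intervalIntegral.hasDerivAt_integral_of_dominated_loc_of_deriv_le
    (μ := volume) (a := 0) (b := T) (x₀ := u)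
    (F := fun w s => (w - s) ^ (-p) * h s)
    (F' := fun w s => (-p) * ((w - s) ^ (-(p+1)) * h s))
    (bound := fun s => p * ((v - s) ^ (-(p+1)) * |h s|)) (s := Ioi v) hnb ?_ ?_ ?_ ?_ ?_ ?_
  · have h1 := key.2
    have h2 : HasDerivAt (fun w => ∫ s in (0:ℝ)..T, (w - s) ^ (-p) * h s) 0 u := by
      refine (hasDerivAt_const u (0:ℝ)).congr_of_eventuallyEq ?_
      filter_upwards [hnb] with w hw
      exact H w (lt_trans hv1 hw)
    have h3 := h1.unique h2
    rw [intervalIntegral.integral_const_mul] at h3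
    rcases mul_eq_zero.1 h3 with h4 | h4
    · linarith
    · exact h4
  · filter_upwards [hnb] with w hw
    exact ((hcont (-p) w (lt_trans hv1 hw)).intervalIntegrable).aestronglyMeasurable_restrict_uIoc
  · exact (hcont (-p) u hu).intervalIntegrable
  · exact (((hcont (-(p+1)) u hu).intervalIntegrable).const_mul (-p)).aestronglyMeasurable_restrict_uIoc
  · refine Filter.Eventually.of_forall fun s hs w hw => ?_
    rw [uIoc_of_le hT.le] at hs
    have hw' : v < w := hw
    have a1 : 0 < v - s := by linarith [hs.2]
    have a2 : 0 < w - s := by linarith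
    rw [norm_mul, norm_mul, Real.norm_eq_abs, Real.norm_eq_abs, Real.norm_eq_abs, abs_neg,
      abs_of_pos hp, abs_of_nonneg (Real.rpow_nonneg a2.le _)]
    have := Real.rpow_le_rpow_of_nonpos a1 (by linarith : v - s ≤ w - s) (by linarith : -(p+1) ≤ 0)
    gcongr
  · apply ContinuousOn.intervalIntegrable
    refine ContinuousOn.mul continuousOn_const ?_
    refine ContinuousOn.mul (ContinuousOn.rpow_const (by fun_prop) ?_) hc.abs.continuousOn
    intro s hs
    rw [uIcc_of_le hT.le] at hs
    left
    linarith [hs.2]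
  · refine Filter.Eventually.of_forall fun s hs w hw => ?_
    rw [uIoc_of_le hT.le] at hs
    have hw' : v < w := hw
    have a2 : 0 < w - s := by linarith [hs.2]
    have d := (((hasDerivAt_id w).sub_const s).rpow_const (p := -p) (Or.inl a2.ne')).mul_const (h s)
    have e : 1 * -p * (id w - s) ^ (-p - 1) * h s = (-p) * ((w - s) ^ (-(p+1)) * h s) := by
      have : -p - 1 = -(p+1) := by ring
      rw [this]
      simp only [id]
      ring
    rw [e] at d
    exact d

open MeasureTheory Set in
lemma frac_zero (h : ℝ → ℝ) (hc : Continuous h) (T : ℝ) (hT : 0 < T) (q : ℝ) (hq : 0 < q)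
    (H : ∀ u > T, ∫ s in (0:ℝ)..T, (u - s) ^ (-q) * h s = 0) :
    ∀ s ∈ Icc 0 T, h s = 0 := by
  have Hk : ∀ k : ℕ, ∀ u > T, ∫ s in (0:ℝ)..T, (u - s) ^ (-(q + k)) * h s = 0 := by
    intro k
    induction k with
    | zero => simpa using H
    | succ k ih =>
      have := frac_deriv_step h hc T hT (q + k) (by positivity) ih
      simpa [add_assoc] using this
  set w : ℝ → ℝ := fun s => (T + 1 - s) ^ (-q) with hw
  have hpos : ∀ s ∈ Icc 0 T, 0 < T + 1 - s := fun s hs => by linarith [hs.2]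
  have hwc : ContinuousOn w (Icc 0 T) :=
    ContinuousOn.rpow_const (by fun_prop) fun s hs => Or.inl (hpos s hs).ne'
  have hic : ContinuousOn (fun s => (T + 1 - s)⁻¹) (Icc 0 T) :=
    ContinuousOn.inv₀ (by fun_prop) fun s hs => (hpos s hs).ne'
  have ii : ∀ g : ℝ → ℝ, ContinuousOn g (Icc 0 T) → IntervalIntegrable g volume 0 T := by
    intro g hg
    apply ContinuousOn.intervalIntegrable
    rwa [uIcc_of_le hT.le]
  have HP : ∀ P : Polynomial ℝ,
      ∫ s in (0:ℝ)..T, w s * h s * P.eval ((T + 1 - s)⁻¹) = 0 := by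
    intro P
    induction P using Polynomial.induction_on' with
    | add P Q hP hQ =>
      simp only [Polynomial.eval_add, mul_add]
      rw [intervalIntegral.integral_add, hP, hQ, add_zero]
      · exact ii _ ((hwc.mul hc.continuousOn).mul (P.continuous.comp_continuousOn hic))
      · exact ii _ ((hwc.mul hc.continuousOn).mul (Q.continuous.comp_continuousOn hic))
    | monomial k a =>
      have : ∫ s in (0:ℝ)..T, a * ((T + 1 - s) ^ (-(q + k)) * h s) = 0 := by
        rw [intervalIntegral.integral_const_mul, Hk k (T+1) (by linarith), mul_zero]
      refine Eq.trans ?_ this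
      apply intervalIntegral.integral_congr
      intro s hs
      rw [uIcc_of_le hT.le] at hs
      have e : (T + 1 - s) ^ (-(q + k)) = (T + 1 - s) ^ (-q) * ((T + 1 - s)⁻¹) ^ k := by
        rw [neg_add, Real.rpow_add (hpos s hs), Real.rpow_neg (hpos s hs).le (k:ℝ),
          Real.rpow_natCast, inv_pow]
      simp only [Polynomial.eval_monomial, hw, e]
      ring
  have hle : ∫ s in (0:ℝ)..T, w s * h s * h s ≤ 0 := by
    set C := ∫ s in (0:ℝ)..T, w s * |h s| with hC
    have hC0 : 0 ≤ C := intervalIntegral.integral_nonneg hT.le fun s hs =>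
      mul_nonneg (Real.rpow_nonneg (hpos s hs).le _) (abs_nonneg _)
    have hb : ∀ ε > 0, ∫ s in (0:ℝ)..T, w s * h s * h s ≤ ε * C := by
      intro ε hε
      obtain ⟨P, hP⟩ := exists_polynomial_near_of_continuousOn (T+1)⁻¹ 1
        (fun y => h (T + 1 - y⁻¹)) (by
          refine hc.comp_continuousOn (continuousOn_const.sub (continuousOn_inv₀.mono ?_))
          intro y hy
          have : 0 < (T+1)⁻¹ := by positivity
          exact (lt_of_lt_of_le this hy.1).ne') ε hε
      have hPi := ii _ ((hwc.mul hc.continuousOn).mul (P.continuous.comp_continuousOn hic))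
      have hhi := ii _ ((hwc.mul hc.continuousOn).mul hc.continuousOn)
      have e1 : ∫ s in (0:ℝ)..T, w s * h s * h s =
          ∫ s in (0:ℝ)..T, (w s * h s * h s - w s * h s * P.eval ((T + 1 - s)⁻¹)) := by
        have := intervalIntegral.integral_sub hhi hPi
        refine Eq.trans ?_ this.symm
        refine Eq.trans (sub_zero _).symm ?_
        exact congrArg _ (HP P).symm
      rw [e1, hC, ← intervalIntegral.integral_const_mul]
      apply intervalIntegral.integral_mono_on hT.le (hhi.sub hPi)
      · exact ii _ (continuousOn_const.mul (hwc.mul hc.abs.continuousOn))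
      · intro s hs
        have hp := hpos s hs
        have := hP ((T + 1 - s)⁻¹) ⟨by
          apply inv_anti₀ hp
          linarith [hs.1], by
          apply inv_le_one_of_one_le₀
          linarith [hs.2]⟩
        simp only [inv_inv, sub_sub_cancel] at this
        have w0 : 0 ≤ w s := Real.rpow_nonneg hp.le _
        calc w s * h s * h s - w s * h s * P.eval ((T + 1 - s)⁻¹)
            = w s * (h s * (h s - P.eval ((T + 1 - s)⁻¹))) := by ring
          _ ≤ w s * (|h s| * ε) := by
            refine mul_le_mul_of_nonneg_left ?_ w0
            refine (le_abs_self _).trans ?_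
            rw [abs_mul, abs_sub_comm]
            exact mul_le_mul_of_nonneg_left this.le (abs_nonneg _)
          _ = ε * (w s * |h s|) := by ring
    by_contra hcon
    push Not at hcon
    have := hb ((∫ s in (0:ℝ)..T, w s * h s * h s) / (2 * (C + 1))) (by positivity)
    rw [div_mul_eq_mul_div, le_div_iff₀ (by positivity)] at this
    nlinarith
  by_contra hcon
  push Not at hcon
  obtain ⟨c, hcI, hcne⟩ := hcon
  have := intervalIntegral.integral_pos hT (f := fun s => w s * h s * h s)
    ((hwc.mul hc.continuousOn).mul hc.continuousOn) (fun s hs => by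
      have := Real.rpow_nonneg (hpos s ⟨hs.1.le, hs.2⟩).le (-q)
      simp only [mul_assoc]
      exact mul_nonneg this (mul_self_nonneg _)) ⟨c, hcI, by
      have := Real.rpow_pos_of_pos (hpos c hcI) (-q)
      simp only [mul_assoc]
      exact mul_pos this (mul_self_pos.2 hcne)⟩
  linarith

open MeasureTheory Set in
lemma frac_scalar (q : ℝ) (hq0 : 0 < q) (hq1 : q < 1) (g : ℝ → ℝ) (hg : ContDiff ℝ 1 g)
    (T : ℝ) (hT : 0 < T) (hper : ∀ t ≥ (0:ℝ), g (t + T) = g t)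
    (hcap : ∀ t > (0:ℝ), caputo q g (t + T) = caputo q g t) :
    ∀ t ≥ (0:ℝ), g t = g 0 := by
  have hc : Continuous (deriv g) := hg.continuous_deriv le_rfl
  have hd : Differentiable ℝ g := hg.differentiable one_ne_zero
  have hdp : ∀ t > 0, deriv g (t + T) = deriv g t := by
    intro t ht
    rw [← deriv_comp_add_const]
    apply Filter.EventuallyEq.deriv_eq
    filter_upwards [Ioi_mem_nhds ht] with s hs
    exact hper s (le_of_lt hs)
  have Hz : ∀ u > T, ∫ s in (0:ℝ)..T, (u - s) ^ (-q) * deriv g s = 0 := by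
    intro u hu
    have ht : 0 < u - T := by linarith
    have h1 := hcap (u - T) ht
    unfold caputo at h1
    have hG : (1 / Real.Gamma (1 - q)) ≠ 0 :=
      one_div_ne_zero (Real.Gamma_pos_of_pos (by linarith)).ne'
    have h2 := mul_left_cancel₀ hG h1
    rw [sub_add_cancel] at h2
    have hint : ∀ a b, IntervalIntegrable (fun s => (u - s) ^ (-q) * deriv g s) volume a b := by
      intro a b
      apply IntervalIntegrable.mul_continuousOn _ hc.continuousOn
      have := (intervalIntegral.intervalIntegrable_rpow' (a := u - a) (b := u - b) (r := -q)
        (by linarith)).comp_sub_left u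
      simpa using this
    rw [← intervalIntegral.integral_add_adjacent_intervals (hint 0 T) (hint T u)] at h2
    have h3 : ∫ s in T..u, (u - s) ^ (-q) * deriv g s =
        ∫ s in (0:ℝ)..(u - T), (u - T - s) ^ (-q) * deriv g s := by
      have := intervalIntegral.integral_comp_add_right (a := 0) (b := u - T)
        (fun s => (u - s) ^ (-q) * deriv g s) T
      rw [zero_add, sub_add_cancel] at this
      rw [← this]
      apply intervalIntegral.integral_congr_ae
      refine Filter.Eventually.of_forall fun s hs => ?_
      rw [uIoc_of_le ht.le] at hs
      simp only [hdp s hs.1]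
      congr 2
      ring
    linarith
  have hz := frac_zero (deriv g) hc T hT q hq0 Hz
  have hI : ∀ t ∈ Icc 0 T, g t = g 0 := by
    intro t ht
    have := intervalIntegral.integral_deriv_eq_sub (a := 0) (b := t) (f := g)
      (fun s _ => hd s) (hc.intervalIntegrable _ _)
    have e : ∫ s in (0:ℝ)..t, deriv g s = ∫ s in (0:ℝ)..t, (0:ℝ) := by
      apply intervalIntegral.integral_congr
      intro s hs
      rw [uIcc_of_le ht.1] at hs
      exact hz s ⟨hs.1, hs.2.trans ht.2⟩
    rw [e] at this
    simp at this
    linarith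
  have hn : ∀ n : ℕ, ∀ t ≥ 0, t ≤ n * T → g t = g 0 := by
    intro n
    induction n with
    | zero =>
      intro t h0 h1
      have : t = 0 := by
        simp at h1
        linarith
      rw [this]
    | succ n ih =>
      intro t h0 h1
      by_cases h : t ≤ T
      · exact hI t ⟨h0, h⟩
      · push Not at h
        have := hper (t - T) (by linarith)
        rw [sub_add_cancel] at this
        rw [this]
        apply ih _ (by linarith)
        push_cast at h1
        linarith
  intro t ht
  obtain ⟨n, hn'⟩ := exists_nat_ge (t / T)
  exact hn n t ht ((div_le_iff₀ hT).1 hn')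



/-- Autonomous fractional-order systems `D*^q x = f (x)` with Caputo derivative of order
`q ∈ (0,1)` cannot have any nonconstant periodic solution: if `x` is continuously
differentiable, satisfies the system componentwise for all `t > 0`, and is `T`-periodic on
`[0,∞)` for some `T > 0`, then `x` is constant on `[0,∞)`. -/
theorem fractional_system_no_nonconstant_periodic_solution
    (q : ℝ) (hq0 : 0 < q) (hq1 : q < 1) (n : ℕ) (hn : 1 ≤ n)
    (f : (Fin n → ℝ) → Fin n → ℝ) (x : ℝ → Fin n → ℝ)
    (hx : ∀ i : Fin n, ContDiff ℝ 1 (fun t => x t i))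
    (hsol : ∀ i : Fin n, ∀ t > (0:ℝ), caputo q (fun s => x s i) t = f (x t) i)
    (T : ℝ) (hT : 0 < T) (hper : ∀ t ≥ (0:ℝ), x (t + T) = x t) :
    ∀ t₁ ≥ (0:ℝ), ∀ t₂ ≥ (0:ℝ), x t₁ = x t₂ := by
  have key : ∀ t ≥ (0:ℝ), ∀ i, x t i = x 0 i := fun t ht i =>
    frac_scalar q hq0 hq1 (fun s => x s i) (hx i) T hT
      (fun t ht => congrFun (hper t ht) i)
      (fun t ht => by
        rw [hsol i t ht, hsol i (t + T) (by linarith), hper t (le_of_lt ht)]) t ht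
  intro t₁ h1 t₂ h2
  funext i
  rw [key t₁ h1, key t₂ h2]
end

section
/- Let q ∈ (0,1) and let x : [0,∞) → ℝ be continuously differentiable, nonconstant, and T-periodic for some T > 0 (x(t+T) = x(t) for all t ≥ 0). Then the Caputo derivative D*^q x is not T-periodic on (0,∞), i.e., there exists t > 0 with D*^q x(t+T) ≠ D*^q x(t). -/
open MeasureTheory Set Filter Topology

lemma aux_step (f : ℝ → ℝ) (hf : Continuous f) (T : ℝ) (hT : 0 < T) (p : ℝ) (hp : 0 < p)
    (h : ∀ u > T, ∫ s in (0:ℝ)..T, (u - s) ^ (-p) * f s = 0) :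
    ∀ u > T, ∫ s in (0:ℝ)..T, (u - s) ^ (-(p + 1)) * f s = 0 := by
  intro u hu
  have cont : ∀ v > T, ∀ r : ℝ, ContinuousOn (fun s => (v - s) ^ r * f s) (uIcc 0 T) := by
    intro v hv r
    rw [uIcc_of_le hT.le]
    refine ContinuousOn.mul (ContinuousOn.rpow_const (by fun_prop) ?_) hf.continuousOn
    intro s hs
    left
    have := hs.2
    intro h0
    linarith
  set d := (u - T) / 2 with hd
  have hdpos : 0 < d := by rw [hd]; linarith
  have key := intervalIntegral.hasDerivAt_integral_of_dominated_loc_of_deriv_le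
    (μ := volume) (a := 0) (b := T) (x₀ := u) (s := Metric.ball u d)
    (F := fun v s => (v - s) ^ (-p) * f s)
    (F' := fun v s => (-p * (v - s) ^ (-p - 1)) * f s)
    (bound := fun s => p * d ^ (-p - 1) * |f s|)
    (Metric.ball_mem_nhds u hdpos) ?_ ?_ ?_ ?_ ?_ ?_
  · have h1 := key.2
    have h2 : HasDerivAt (fun v : ℝ => ∫ s in (0:ℝ)..T, (v - s) ^ (-p) * f s) 0 u := by
      refine (hasDerivAt_const u (0:ℝ)).congr_of_eventuallyEq ?_
      filter_upwards [lt_mem_nhds hu] with v hv using h v hv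
    have h3 := h1.unique h2
    simp only [mul_assoc] at h3
    rw [intervalIntegral.integral_const_mul] at h3
    have : -(p + 1) = -p - 1 := by ring
    rw [this]
    rcases mul_eq_zero.1 h3 with h4 | h4
    · linarith
    · exact h4
  · filter_upwards [lt_mem_nhds hu] with v hv
    exact (intervalIntegrable_iff.1 (cont v hv _).intervalIntegrable).aestronglyMeasurable
  · exact (cont u hu _).intervalIntegrable
  · have := ((cont u hu (-p - 1)).const_smul (-p)).intervalIntegrable (μ := volume)
    have := (intervalIntegrable_iff.1 this).aestronglyMeasurable
    refine this.congr (Eventually.of_forall fun s => ?_)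
    simp [mul_assoc]
  · refine Eventually.of_forall fun s hs v hv => ?_
    rw [uIoc_of_le hT.le] at hs
    rw [Metric.mem_ball, Real.dist_eq, abs_lt] at hv
    have h1 : d ≤ v - s := by linarith [hs.2]
    rw [Real.norm_eq_abs, abs_mul, abs_mul, abs_neg, abs_of_pos hp,
      abs_of_nonneg (Real.rpow_nonneg (hdpos.le.trans h1) _)]
    have := Real.rpow_le_rpow_of_nonpos hdpos h1 (by linarith : -p - 1 ≤ 0)
    gcongr
  · exact (Continuous.intervalIntegrable (by fun_prop) _ _)
  · refine Eventually.of_forall fun s hs v hv => ?_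
    rw [uIoc_of_le hT.le] at hs
    rw [Metric.mem_ball, Real.dist_eq, abs_lt] at hv
    have h1 : v - s ≠ 0 := by
      have : 0 < v - s := by linarith [hs.2]
      exact this.ne'
    have := (((hasDerivAt_id v).sub_const s).rpow_const (p := -p) (Or.inl h1)).mul_const (f s)
    simpa using this

lemma aux_zero (f : ℝ → ℝ) (hf : Continuous f) (T : ℝ) (hT : 0 < T) (q : ℝ) (hq : 0 < q)
    (h : ∀ u > T, ∫ s in (0:ℝ)..T, (u - s) ^ (-q) * f s = 0) :
    ∀ s ∈ Icc 0 T, f s = 0 := by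
  have hn : ∀ n : ℕ, ∀ u > T, ∫ s in (0:ℝ)..T, (u - s) ^ (-(q + n)) * f s = 0 := by
    intro n
    induction n with
    | zero => simpa using h
    | succ n ih =>
      have := aux_step f hf T hT (q + n) (by positivity) ih
      push_cast
      simpa [add_assoc] using this
  have hpos : ∀ s ∈ Icc (0:ℝ) T, 0 < T + 1 - s := fun s hs => by linarith [hs.2]
  set g : ℝ → ℝ := fun s => (T + 1 - s) ^ (-q) * f s with hg
  have gc : ContinuousOn g (Icc 0 T) := by
    refine ContinuousOn.mul (ContinuousOn.rpow_const (by fun_prop) ?_) hf.continuousOn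
    intro s hs
    exact Or.inl (hpos s hs).ne'
  have wc : ContinuousOn (fun s : ℝ => (T + 1 - s)⁻¹) (Icc 0 T) :=
    ContinuousOn.inv₀ (by fun_prop) fun s hs => (hpos s hs).ne'
  have hmono : ∀ n : ℕ, ∫ s in (0:ℝ)..T, g s * ((T + 1 - s)⁻¹) ^ n = 0 := by
    intro n
    refine Eq.trans ?_ (hn n (T + 1) (by linarith))
    apply intervalIntegral.integral_congr
    intro s hs
    rw [uIcc_of_le hT.le] at hs
    have := hpos s hs
    simp only [hg]
    rw [neg_add, Real.rpow_add this, Real.rpow_neg this.le (n : ℝ), Real.rpow_natCast, inv_pow]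
    ring
  have ii : ∀ k : ℝ → ℝ, ContinuousOn k (Icc 0 T) → IntervalIntegrable k volume 0 T := by
    intro k hk
    rw [← uIcc_of_le hT.le] at hk
    exact hk.intervalIntegrable
  have hpoly : ∀ P : Polynomial ℝ, ∫ s in (0:ℝ)..T, g s * P.eval ((T + 1 - s)⁻¹) = 0 := by
    intro P
    induction P using Polynomial.induction_on' with
    | add P Q hP hQ =>
      simp only [Polynomial.eval_add, mul_add]
      rw [intervalIntegral.integral_add, hP, hQ, add_zero]
      · exact ii _ (gc.mul (P.continuous.comp_continuousOn wc))
      · exact ii _ (gc.mul (Q.continuous.comp_continuousOn wc))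
    | monomial n a =>
      simp only [Polynomial.eval_monomial]
      have := hmono n
      simp only [mul_left_comm _ a]
      rw [intervalIntegral.integral_const_mul, this, mul_zero]
  set M := ∫ s in (0:ℝ)..T, |g s| with hM
  have hM0 : 0 ≤ M := intervalIntegral.integral_nonneg hT.le fun s _ => abs_nonneg _
  have hle : ∫ s in (0:ℝ)..T, g s * g s ≤ 0 := by
    refine le_of_forall_pos_le_add fun ε hε => ?_
    set δ := ε / (M + 1) with hδ
    have hδ0 : 0 < δ := by positivity
    have hT1 : (0:ℝ) < (T + 1)⁻¹ := by positivity
    have φc : ContinuousOn (fun y : ℝ => g (T + 1 - y⁻¹)) (Icc (T + 1)⁻¹ 1) := by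
      refine gc.comp (ContinuousOn.sub continuousOn_const
        (continuousOn_id.inv₀ fun y hy => (hT1.trans_le hy.1).ne')) ?_
      intro y hy
      have hy0 := hT1.trans_le hy.1
      have h1 : y⁻¹ ≤ T + 1 := inv_le_of_inv_le₀ (by positivity) hy.1
      have h2 : 1 ≤ y⁻¹ := (one_le_inv₀ hy0).2 hy.2
      constructor <;> simp <;> linarith
    obtain ⟨P, hP⟩ := exists_polynomial_near_of_continuousOn _ _ _ φc δ hδ0
    have hP' : ∀ s ∈ Icc 0 T, |P.eval ((T + 1 - s)⁻¹) - g s| < δ := by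
      intro s hs
      have := hP ((T + 1 - s)⁻¹) ⟨by
        have := hpos s hs
        gcongr
        linarith [hs.1], inv_le_one_of_one_le₀ (by linarith [hs.2])⟩
      simpa using this
    have pc := P.continuous.comp_continuousOn wc
    calc ∫ s in (0:ℝ)..T, g s * g s
        = (∫ s in (0:ℝ)..T, g s * g s) - ∫ s in (0:ℝ)..T, g s * P.eval ((T + 1 - s)⁻¹) := by
          rw [hpoly, sub_zero]
      _ = ∫ s in (0:ℝ)..T, (g s * g s - g s * P.eval ((T + 1 - s)⁻¹)) := by
          exact (intervalIntegral.integral_sub (ii _ (gc.mul gc)) (ii _ (gc.mul pc))).symm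
      _ ≤ ∫ s in (0:ℝ)..T, δ * |g s| := by
          refine intervalIntegral.integral_mono_on hT.le (ii _ ((gc.mul gc).sub (gc.mul pc)))
            (ii _ (continuousOn_const.mul gc.abs)) fun s hs => ?_
          have h1 := hP' s hs
          rw [← mul_sub]
          refine (le_abs_self _).trans ?_
          rw [abs_mul, mul_comm, abs_sub_comm]
          gcongr
      _ = δ * M := by rw [intervalIntegral.integral_const_mul]
      _ ≤ 0 + ε := by
          rw [hδ, zero_add, div_mul_eq_mul_div, div_le_iff₀ (by positivity)]
          nlinarith
  intro s hs
  by_contra hne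
  have hgs : g s ≠ 0 := mul_ne_zero (Real.rpow_pos_of_pos (hpos s hs) _).ne' hne
  have := intervalIntegral.integral_pos (f := fun s => g s * g s) hT (gc.mul gc)
    (fun y _ => mul_self_nonneg _) ⟨s, hs, mul_self_pos.2 hgs⟩
  linarith

/-- If `x` is continuously differentiable, nonconstant on `[0,∞)`, and `T`-periodic on
`[0,∞)` for some `T > 0`, then its Caputo derivative of order `q ∈ (0,1)` is not
`T`-periodic on `(0,∞)`: there exists `t > 0` with `D*^q x (t+T) ≠ D*^q x (t)`. -/
theorem caputo_deriv_of_periodic_not_periodic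
    (q : ℝ) (hq0 : 0 < q) (hq1 : q < 1) (x : ℝ → ℝ)
    (hx : ContDiff ℝ 1 x)
    (hnonconst : ∃ t₁ ≥ (0:ℝ), ∃ t₂ ≥ (0:ℝ), x t₁ ≠ x t₂)
    (T : ℝ) (hT : 0 < T) (hper : ∀ t ≥ (0:ℝ), x (t + T) = x t) :
    ∃ t > (0:ℝ), caputo q x (t + T) ≠ caputo q x t := by
  by_contra! hcon
  have hdc : Continuous (deriv x) := hx.continuous_deriv le_rfl
  have hdiff : Differentiable ℝ x := hx.differentiable (by norm_num)
  have hdper : ∀ s > 0, deriv x (s + T) = deriv x s := by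
    intro s hs
    rw [← deriv_comp_add_const]
    refine Filter.EventuallyEq.deriv_eq ?_
    filter_upwards [lt_mem_nhds hs] with v hv using hper v hv.le
  have hG : 1 / Real.Gamma (1 - q) ≠ 0 :=
    one_div_ne_zero (Real.Gamma_pos_of_pos (by linarith)).ne'
  have hz : ∀ u > T, ∫ s in (0:ℝ)..T, (u - s) ^ (-q) * deriv x s = 0 := by
    intro u hu
    have h1 := hcon (u - T) (by linarith)
    unfold caputo at h1
    have h2 := mul_left_cancel₀ hG h1
    rw [sub_add_cancel] at h2
    have i0 : IntervalIntegrable (fun s => (u - s) ^ (-q) * deriv x s) volume 0 u := by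
      refine IntervalIntegrable.mul_continuousOn ?_ hdc.continuousOn
      have := (intervalIntegral.intervalIntegrable_rpow' (a := u) (b := 0) (r := -q)
        (by linarith)).comp_sub_left u
      simpa using this
    have i1 : IntervalIntegrable (fun s => (u - s) ^ (-q) * deriv x s) volume 0 T :=
      i0.mono_set (by
        rw [uIcc_of_le hT.le, uIcc_of_le (hT.trans hu).le]
        exact Icc_subset_Icc_right hu.le)
    have i2 : IntervalIntegrable (fun s => (u - s) ^ (-q) * deriv x s) volume T u :=
      i0.mono_set (by
        rw [uIcc_of_le hu.le, uIcc_of_le (hT.trans hu).le]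
        exact Icc_subset_Icc_left hT.le)
    rw [← intervalIntegral.integral_add_adjacent_intervals i1 i2] at h2
    have h3 : ∫ s in T..u, (u - s) ^ (-q) * deriv x s
        = ∫ s in (0:ℝ)..(u - T), (u - T - s) ^ (-q) * deriv x s := by
      have := intervalIntegral.integral_comp_add_right (a := 0) (b := u - T)
        (fun s => (u - s) ^ (-q) * deriv x s) T
      rw [zero_add, sub_add_cancel] at this
      rw [← this]
      refine intervalIntegral.integral_congr_ae (Eventually.of_forall fun s hs => ?_)
      rw [uIoc_of_le (by linarith)] at hs
      rw [hdper s hs.1]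
      congr 2
      ring
    linarith
  have hd0 := aux_zero _ hdc T hT q hq0 hz
  have hc : ∀ s ∈ Icc 0 T, x s = x 0 := by
    refine constant_of_derivWithin_zero hdiff.differentiableOn fun s hs => ?_
    rw [(hdiff s).derivWithin (uniqueDiffOn_Icc hT s (Ico_subset_Icc_self hs))]
    exact hd0 s (Ico_subset_Icc_self hs)
  have hN : ∀ n : ℕ, ∀ s ≥ 0, x (s + n * T) = x s := by
    intro n
    induction n with
    | zero => simp
    | succ n ih =>
      intro s hs
      rw [← ih s hs, ← hper (s + n * T) (by positivity)]
      congr 1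
      push_cast
      ring
  have hall : ∀ t ≥ 0, x t = x 0 := by
    intro t ht
    have h1 : (⌊t / T⌋₊ : ℝ) ≤ t / T := Nat.floor_le (by positivity)
    have h2 := Nat.lt_floor_add_one (t / T)
    rw [le_div_iff₀ hT] at h1
    rw [div_lt_iff₀ hT] at h2
    have := hN ⌊t / T⌋₊ (t - ⌊t / T⌋₊ * T) (by linarith)
    rw [sub_add_cancel] at this
    rw [this]
    exact hc _ ⟨by linarith, by linarith⟩
  obtain ⟨a, ha, b, hb, hab⟩ := hnonconst
  exact hab ((hall a ha).trans (hall b hb).symm)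
end
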